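/- Let d ≥ 3 and 1 ≤ p < d/2, and let μ be a finite singular (with respect to Lebesgue measure) Borel measure on [0,1)^d. Let μ̂_N denote the empirical measure of N i.i.d. points with distribution μ/‖μ‖. Then lim_{N→∞} N^{1/d} · E[ρ_p^p(μ/‖μ‖, μ̂_N)]^{1/p} = 0. -/

import Mathlib

open MeasureTheory ENNReal

/-- The set of couplings (transports) between two measures on `ℝ^d`. -/
def couplings {d : ℕ} (μ ν : Measure (Fin d → ℝ)) :
    Set (Measure ((Fin d → ℝ) × (Fin d → ℝ))) :=
  {ξ | ξ.map Prod.fst = μ ∧ ξ.map Prod.snd = ν}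

/-- `ρ_p^p(μ,ν)`: the `p`-th power of the `p`-th Wasserstein metric. -/
noncomputable def WpPow {d : ℕ} (p : ℝ) (μ ν : Measure (Fin d → ℝ)) : ℝ≥0∞ :=
  ⨅ ξ ∈ couplings μ ν, ∫⁻ z, (‖z.1 - z.2‖₊ : ℝ≥0∞) ^ p ∂ξ

/-- The empirical measure `(1/N) ∑_{j<N} δ_{x_j}` of a vector of `N` points. -/
noncomputable def empMeas {d : ℕ} (N : ℕ) (x : Fin N → (Fin d → ℝ)) :
    Measure (Fin d → ℝ) :=
  (N : ℝ≥0∞)⁻¹ • ∑ j, Measure.dirac (x j)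

/-- `E[ρ_p^p(μ, μ̂_N)]`: the expected `p`-th power Wasserstein distance between `μ`
and the empirical measure of `N` i.i.d. `μ`-distributed samples (modelled on the
canonical product space). -/
noncomputable def expWpPow {d : ℕ} (p : ℝ) (μ : Measure (Fin d → ℝ)) (N : ℕ) :
    ℝ≥0∞ :=
  ∫⁻ x, WpPow p μ (empMeas N x) ∂(Measure.pi fun _ : Fin N => μ)

/-- The unit cube `[0,1)^d`. -/
def unitBox (d : ℕ) : Set (Fin d → ℝ) := Set.univ.pi fun _ => Set.Ico (0 : ℝ) 1

open Filter Topology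

lemma sum_restrict_fiber {X ι : Type*} [MeasurableSpace X] [MeasurableSpace ι] [Countable ι]
    [MeasurableSingletonClass ι] {c : X → ι} (hc : Measurable c) (α : Measure X) :
    Measure.sum (fun q => α.restrict (c ⁻¹' {q})) = α := by
  rw [← Measure.restrict_iUnion]
  · have : (⋃ q, c ⁻¹' {q}) = Set.univ := by ext x; simp
    rw [this, Measure.restrict_univ]
  · intro a b hab
    refine Disjoint.preimage _ ?_
    simpa using hab
  · exact fun q => hc (measurableSet_singleton q)

lemma tsum_measure_fiber {X ι : Type*} [MeasurableSpace X] [MeasurableSpace ι] [Countable ι]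
    [MeasurableSingletonClass ι] {c : X → ι} (hc : Measurable c) (α : Measure X) :
    ∑' q, α (c ⁻¹' {q}) = α Set.univ := by
  conv_rhs => rw [← sum_restrict_fiber hc α]
  rw [Measure.sum_apply _ MeasurableSet.univ]
  simp

/-- Two finite measures giving the same mass to every fibre of a countably valued map can be
coupled fibrewise, so that the coupling moves mass at most by the diameter of the fibres. -/
lemma exists_coupling_of_map_eq {d : ℕ} {ι : Type*} [MeasurableSpace ι] [Countable ι]
    [MeasurableSingletonClass ι] {c : (Fin d → ℝ) → ι} (hc : Measurable c)
    (α β : Measure (Fin d → ℝ)) [IsFiniteMeasure α] [IsFiniteMeasure β]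
    (h : ∀ q, α (c ⁻¹' {q}) = β (c ⁻¹' {q})) {D : ℝ≥0∞}
    (hD : ∀ x y, c x = c y → (‖x - y‖₊ : ℝ≥0∞) ≤ D) {p : ℝ} (hp : 0 ≤ p) :
    ∃ ξ ∈ couplings α β, ∫⁻ z, (‖z.1 - z.2‖₊ : ℝ≥0∞) ^ p ∂ξ ≤ D ^ p * α Set.univ := by
  have hm : ∀ q, MeasurableSet (c ⁻¹' {q}) := fun q => hc (measurableSet_singleton q)
  refine ⟨Measure.sum fun q => (α (c ⁻¹' {q}))⁻¹ •
    ((α.restrict (c ⁻¹' {q})).prod (β.restrict (c ⁻¹' {q}))), ⟨?_, ?_⟩, ?_⟩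
  · rw [Measure.map_sum measurable_fst.aemeasurable]
    conv_rhs => rw [← sum_restrict_fiber hc α]
    congr 1
    ext1 q
    rw [Measure.map_smul, Measure.map_fst_prod, Measure.restrict_apply_univ, ← h q, smul_smul]
    by_cases h0 : α (c ⁻¹' {q}) = 0
    · simp [Measure.restrict_eq_zero.2 h0]
    · rw [ENNReal.inv_mul_cancel h0 (measure_ne_top _ _), one_smul]
  · rw [Measure.map_sum measurable_snd.aemeasurable]
    conv_rhs => rw [← sum_restrict_fiber hc β]
    congr 1
    ext1 q
    rw [Measure.map_smul, Measure.map_snd_prod, Measure.restrict_apply_univ, h q, smul_smul]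
    by_cases h0 : β (c ⁻¹' {q}) = 0
    · simp [Measure.restrict_eq_zero.2 h0]
    · rw [ENNReal.inv_mul_cancel h0 (measure_ne_top _ _), one_smul]
  · rw [lintegral_sum_measure, ← tsum_measure_fiber hc α, ← ENNReal.tsum_mul_left]
    refine ENNReal.tsum_le_tsum fun q => ?_
    rw [lintegral_smul_measure, Measure.prod_restrict, smul_eq_mul]
    have hle : ∫⁻ z in (c ⁻¹' {q}) ×ˢ (c ⁻¹' {q}), (‖z.1 - z.2‖₊ : ℝ≥0∞) ^ p ∂(α.prod β)
        ≤ D ^ p * (α (c ⁻¹' {q}) * α (c ⁻¹' {q})) := by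
      calc _ ≤ ∫⁻ z in (c ⁻¹' {q}) ×ˢ (c ⁻¹' {q}), D ^ p ∂(α.prod β) := by
            refine setLIntegral_mono' ((hm q).prod (hm q)) fun z hz => ?_
            refine ENNReal.rpow_le_rpow (hD _ _ ?_) hp
            simp only [Set.mem_prod, Set.mem_preimage, Set.mem_singleton_iff] at hz
            rw [hz.1, hz.2]
        _ = _ := by rw [setLIntegral_const, Measure.prod_prod, h q]
    by_cases h0 : α (c ⁻¹' {q}) = 0
    · rw [h0] at hle
      simp only [mul_zero, nonpos_iff_eq_zero] at hle
      simp [hle]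
    · calc _ ≤ (α (c ⁻¹' {q}))⁻¹ * (D ^ p * (α (c ⁻¹' {q}) * α (c ⁻¹' {q}))) := by gcongr
        _ = ((α (c ⁻¹' {q}))⁻¹ * α (c ⁻¹' {q})) * (D ^ p * α (c ⁻¹' {q})) := by ring
        _ = _ := by rw [ENNReal.inv_mul_cancel h0 (measure_ne_top _ _), one_mul]

/-- A finite measure splits into a part with fibre masses `min (α Q) (β Q)` and a remainder. -/
lemma exists_split_min {X ι : Type*} [MeasurableSpace X] [MeasurableSpace ι] [Countable ι]
    [MeasurableSingletonClass ι] {c : X → ι} (hc : Measurable c)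
    (α β : Measure X) [IsFiniteMeasure α] :
    ∃ α' α'' : Measure X, α' + α'' = α ∧
      ∀ q, α' (c ⁻¹' {q}) = min (α (c ⁻¹' {q})) (β (c ⁻¹' {q})) := by
  let f : ι → ℝ≥0∞ := fun q => min 1 (β (c ⁻¹' {q}) / α (c ⁻¹' {q}))
  have hf : Measurable fun x => f (c x) := (measurable_of_countable f).comp hc
  refine ⟨α.withDensity fun x => f (c x), α.withDensity fun x => 1 - f (c x), ?_, fun q => ?_⟩
  · rw [← withDensity_add_left hf]
    have : ((fun x => f (c x)) + fun x => 1 - f (c x)) = 1 := by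
      ext x
      exact add_tsub_cancel_of_le (min_le_left _ _)
    rw [this, withDensity_one]
  · have hm : MeasurableSet (c ⁻¹' {q}) := hc (measurableSet_singleton q)
    rw [withDensity_apply _ hm]
    have : ∫⁻ x in c ⁻¹' {q}, f (c x) ∂α = ∫⁻ x in c ⁻¹' {q}, f q ∂α := by
      refine setLIntegral_congr_fun hm fun x hx => ?_
      rw [Set.mem_preimage, Set.mem_singleton_iff] at hx
      simp only [hx]
    rw [this, setLIntegral_const]
    by_cases h0 : α (c ⁻¹' {q}) = 0
    · simp [h0]
    · simp only [f]
      rw [min_mul_of_nonneg _ _ zero_le, one_mul,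
        ENNReal.div_mul_cancel h0 (measure_ne_top _ _)]

/-- Hierarchical coupling along a refining sequence of countable partitions: mass is matched as
far as possible at the finest level, and the leftovers are matched at coarser and coarser
levels. -/
lemma exists_coupling_hierarchical {d : ℕ} {ι : Type*} [MeasurableSpace ι] [Countable ι]
    [MeasurableSingletonClass ι] {c : ℕ → (Fin d → ℝ) → ι} (hc : ∀ n, Measurable (c n))
    (hnest : ∀ k n, k ≤ n → ∃ g : ι → ι, c k = g ∘ c n) {D : ℕ → ℝ≥0∞}
    (hD : ∀ n x y, c n x = c n y → (‖x - y‖₊ : ℝ≥0∞) ≤ D n) {p : ℝ} (hp : 0 ≤ p) (n : ℕ) :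
    ∀ (α β : Measure (Fin d → ℝ)) [IsFiniteMeasure α] [IsFiniteMeasure β],
    (∀ q, α (c 0 ⁻¹' {q}) = β (c 0 ⁻¹' {q})) →
    ∃ ξ ∈ couplings α β, ∫⁻ z, (‖z.1 - z.2‖₊ : ℝ≥0∞) ^ p ∂ξ ≤
      D n ^ p * α Set.univ + ∑ k ∈ Finset.range n, D k ^ p *
        ∑' q, (α (c (k + 1) ⁻¹' {q}) - β (c (k + 1) ⁻¹' {q})) := by
  induction n with
  | zero =>
    intro α β _ _ h
    simpa using exists_coupling_of_map_eq (hc 0) α β h (hD 0) hp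
  | succ n ih =>
    intro α β _ _ h
    obtain ⟨α', α'', hα, hα'⟩ := exists_split_min (hc (n + 1)) α β
    obtain ⟨β', β'', hβ, hβ'⟩ := exists_split_min (hc (n + 1)) β α
    have hαle : α' ≤ α := hα ▸ Measure.le_add_right le_rfl
    have hβle : β' ≤ β := hβ ▸ Measure.le_add_right le_rfl
    have hαle' : α'' ≤ α := hα ▸ Measure.le_add_left le_rfl
    have hβle' : β'' ≤ β := hβ ▸ Measure.le_add_left le_rfl
    have := isFiniteMeasure_of_le α hαle
    have := isFiniteMeasure_of_le β hβle
    have := isFiniteMeasure_of_le α hαle'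
    have := isFiniteMeasure_of_le β hβle'
    have heq : ∀ q, α' (c (n + 1) ⁻¹' {q}) = β' (c (n + 1) ⁻¹' {q}) := fun q => by
      rw [hα', hβ', min_comm]
    have heqk : ∀ k ≤ n + 1, ∀ q, α' (c k ⁻¹' {q}) = β' (c k ⁻¹' {q}) := by
      intro k hk q
      obtain ⟨g, hg⟩ := hnest k (n + 1) hk
      have hmap : α'.map (c (n + 1)) = β'.map (c (n + 1)) := by
        refine Measure.ext_of_singleton fun q => ?_
        rw [Measure.map_apply (hc _) (measurableSet_singleton q),
          Measure.map_apply (hc _) (measurableSet_singleton q), heq]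
      have hS : MeasurableSet (g ⁻¹' {q}) := (Set.to_countable _).measurableSet
      rw [hg, Set.preimage_comp, ← Measure.map_apply (hc _) hS, hmap,
        Measure.map_apply (hc _) hS]
    have hsub : ∀ k ≤ n + 1, ∀ q, α'' (c k ⁻¹' {q}) - β'' (c k ⁻¹' {q}) =
        α (c k ⁻¹' {q}) - β (c k ⁻¹' {q}) := by
      intro k hk q
      rw [← hα, ← hβ, Measure.add_apply, Measure.add_apply, heqk k hk q,
        ENNReal.add_sub_add_eq_sub_left (measure_ne_top _ _)]
    have hzero : ∀ q, α'' (c 0 ⁻¹' {q}) = β'' (c 0 ⁻¹' {q}) := by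
      intro q
      have := h q
      rw [← hα, ← hβ, Measure.add_apply, Measure.add_apply, heqk 0 (by omega) q] at this
      exact (ENNReal.add_right_inj (measure_ne_top _ _)).1 this
    have hmass : α'' Set.univ =
        ∑' q, (α (c (n + 1) ⁻¹' {q}) - β (c (n + 1) ⁻¹' {q})) := by
      rw [← tsum_measure_fiber (hc (n + 1)) α'']
      congr 1
      ext1 q
      have h1 : α (c (n + 1) ⁻¹' {q}) = α' (c (n + 1) ⁻¹' {q}) + α'' (c (n + 1) ⁻¹' {q}) := by
        rw [← Measure.add_apply, hα]
      have h2 := hα' q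
      rcases le_total (α (c (n + 1) ⁻¹' {q})) (β (c (n + 1) ⁻¹' {q})) with hle | hle
      · rw [tsub_eq_zero_of_le hle]
        rw [min_eq_left hle] at h2
        rw [h2] at h1
        exact (ENNReal.add_right_inj (measure_ne_top α (c (n + 1) ⁻¹' {q}))).1
          (by rw [add_zero, ← h1])
      · rw [min_eq_right hle] at h2
        rw [h1, h2, ENNReal.add_sub_cancel_left (h2 ▸ measure_ne_top _ _)]
    obtain ⟨ξ₁, ⟨hf₁, hs₁⟩, hc₁⟩ := exists_coupling_of_map_eq (hc (n + 1)) α' β' heq (hD _) hp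
    obtain ⟨ξ₂, ⟨hf₂, hs₂⟩, hc₂⟩ := ih α'' β'' hzero
    refine ⟨ξ₁ + ξ₂, ⟨?_, ?_⟩, ?_⟩
    · rw [Measure.map_add _ _ measurable_fst, hf₁, hf₂, hα]
    · rw [Measure.map_add _ _ measurable_snd, hs₁, hs₂, hβ]
    · rw [lintegral_add_measure, Finset.sum_range_succ, ← hmass]
      have hS : ∑ k ∈ Finset.range n, D k ^ p *
          ∑' q, (α'' (c (k + 1) ⁻¹' {q}) - β'' (c (k + 1) ⁻¹' {q})) =
          ∑ k ∈ Finset.range n, D k ^ p *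
          ∑' q, (α (c (k + 1) ⁻¹' {q}) - β (c (k + 1) ⁻¹' {q})) := by
        refine Finset.sum_congr rfl fun k hk => ?_
        have := Finset.mem_range.1 hk
        simp_rw [hsub (k + 1) (by omega)]
      rw [hS] at hc₂
      calc _ ≤ D (n + 1) ^ p * α' Set.univ + _ := add_le_add hc₁ hc₂
        _ ≤ D (n + 1) ^ p * α Set.univ + _ := by gcongr
        _ = _ := by ring

/-- The index of the dyadic cube of side length `2⁻ⁿ` containing a point. -/
noncomputable def cellMap (d n : ℕ) (x : Fin d → ℝ) : Fin d → ℤ := fun i => ⌊(2 : ℝ) ^ n * x i⌋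

/-- The indices of the dyadic cubes of side length `2⁻ⁿ` contained in the unit cube. -/
noncomputable def cells (d n : ℕ) : Finset (Fin d → ℤ) := Fintype.piFinset fun _ => Finset.Ico 0 (2 ^ n)

lemma card_cells (d n : ℕ) : (cells d n).card = 2 ^ (d * n) := by
  have : ((2 : ℤ) ^ n).toNat = 2 ^ n := by exact_mod_cast Int.toNat_natCast (2 ^ n)
  simp [cells, Fintype.card_piFinset, this, ← pow_mul, mul_comm]

lemma measurable_cellMap (d n : ℕ) : Measurable (cellMap d n) := by
  unfold cellMap
  fun_prop

lemma cellMap_factors (d k n : ℕ) (h : k ≤ n) :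
    ∃ g : (Fin d → ℤ) → (Fin d → ℤ), cellMap d k = g ∘ cellMap d n := by
  refine ⟨fun z i => z i / ((2 ^ (n - k) : ℕ) : ℤ), ?_⟩
  ext x i
  simp only [cellMap, Function.comp_apply]
  rw [← Int.mul_natCast_floor_div_cancel (n := 2 ^ (n - k)) (by positivity)]
  congr 2
  push_cast
  rw [mul_right_comm, ← pow_add, Nat.add_sub_cancel' h]

lemma nnnorm_sub_le_of_cellMap_eq (d n : ℕ) (x y : Fin d → ℝ) (h : cellMap d n x = cellMap d n y) :
    (‖x - y‖₊ : ℝ≥0∞) ≤ ENNReal.ofReal ((1 / 2) ^ n) := by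
  rw [← enorm_eq_nnnorm, ← ofReal_norm]
  refine ENNReal.ofReal_le_ofReal ?_
  rw [pi_norm_le_iff_of_nonneg (by positivity)]
  intro i
  have hi : ⌊(2 : ℝ) ^ n * x i⌋ = ⌊(2 : ℝ) ^ n * y i⌋ := congrFun h i
  have h1 := Int.abs_sub_lt_one_of_floor_eq_floor hi
  rw [← mul_sub, abs_mul, abs_of_pos (by positivity : (0 : ℝ) < 2 ^ n)] at h1
  rw [Pi.sub_apply, Real.norm_eq_abs, one_div, inv_pow, ← one_div, le_div_iff₀ (by positivity)]
  linarith

lemma unitBox_eq_fiber (d : ℕ) : unitBox d = cellMap d 0 ⁻¹' {0} := by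
  ext x
  simp [unitBox, cellMap, funext_iff, Int.floor_eq_zero_iff]

lemma cellMap_mem_cells {d : ℕ} (n : ℕ) {x : Fin d → ℝ} (hx : x ∈ unitBox d) :
    cellMap d n x ∈ cells d n := by
  simp only [cells, Fintype.mem_piFinset, Finset.mem_Ico, cellMap]
  intro i
  have hi : x i ∈ Set.Ico (0 : ℝ) 1 := hx i (Set.mem_univ _)
  have h2 : (0 : ℝ) < 2 ^ n := by positivity
  refine ⟨Int.floor_nonneg.2 (mul_nonneg h2.le hi.1), Int.floor_lt.2 ?_⟩
  push_cast
  nlinarith [hi.2]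

lemma volume_cell (d n : ℕ) (q : Fin d → ℤ) :
    volume (cellMap d n ⁻¹' {q}) = ENNReal.ofReal (((2 : ℝ) ^ (d * n))⁻¹) := by
  have h2 : (0 : ℝ) < 2 ^ n := by positivity
  have : cellMap d n ⁻¹' {q} = Set.univ.pi
      fun i => Set.Ico ((q i : ℝ) / 2 ^ n) (((q i : ℝ) + 1) / 2 ^ n) := by
    ext x
    simp only [Set.mem_preimage, Set.mem_singleton_iff, funext_iff, cellMap, Int.floor_eq_iff,
      Set.mem_pi, Set.mem_univ, true_imp_iff, Set.mem_Ico, div_le_iff₀ h2, lt_div_iff₀ h2,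
      mul_comm]
  rw [this, Real.volume_pi_Ico]
  simp only [← sub_div, add_sub_cancel_left, Finset.prod_const, Finset.card_univ,
    Fintype.card_fin]
  rw [← ENNReal.ofReal_pow (by positivity), one_div, inv_pow, ← pow_mul, mul_comm]

lemma measure_cell_of_unitBox {d : ℕ} {α : Measure (Fin d → ℝ)} [IsProbabilityMeasure α]
    (hα : α (unitBox d)ᶜ = 0) (q : Fin d → ℤ) :
    α (cellMap d 0 ⁻¹' {q}) = if q = 0 then 1 else 0 := by
  split_ifs with h
  · rw [h, ← unitBox_eq_fiber]
    refine (prob_compl_eq_zero_iff ?_).1 hα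
    rw [unitBox_eq_fiber]
    exact measurable_cellMap d 0 (measurableSet_singleton 0)
  · refine measure_mono_null ?_ hα
    rw [unitBox_eq_fiber]
    intro x hx hx'
    exact h (hx.symm.trans hx')

lemma measure_cell_eq_zero {d n : ℕ} {α : Measure (Fin d → ℝ)}
    (hα : α (unitBox d)ᶜ = 0) {q : Fin d → ℤ} (hq : q ∉ cells d n) :
    α (cellMap d n ⁻¹' {q}) = 0 := by
  refine measure_mono_null ?_ hα
  intro x hx hx'
  exact hq (hx ▸ cellMap_mem_cells n hx')

lemma isProbabilityMeasure_empMeas {d N : ℕ} (hN : N ≠ 0) (x : Fin N → (Fin d → ℝ)) :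
    IsProbabilityMeasure (empMeas N x) := by
  refine ⟨?_⟩
  simp [empMeas, ENNReal.inv_mul_cancel (Nat.cast_ne_zero.2 hN)]

lemma empMeas_apply {d N : ℕ} (x : Fin N → (Fin d → ℝ)) {Q : Set (Fin d → ℝ)}
    (hQ : MeasurableSet Q) :
    empMeas N x Q = (N : ℝ≥0∞)⁻¹ * ∑ j, Q.indicator 1 (x j) := by
  simp [empMeas, Measure.dirac_apply' _ hQ]

open ProbabilityTheory in
/-- The expected deficit of the empirical mass of a set is at most its standard deviation. -/
lemma lintegral_sub_empMeas_le {d N : ℕ} (hN : N ≠ 0) (ν : Measure (Fin d → ℝ))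
    [IsProbabilityMeasure ν] {Q : Set (Fin d → ℝ)} (hQ : MeasurableSet Q) :
    ∫⁻ x, (ν Q - empMeas N x Q) ∂(Measure.pi fun _ : Fin N => ν) ≤
      ENNReal.ofReal (√(ν.real Q) / √N) := by
  set P := Measure.pi fun _ : Fin N => ν
  have hN0 : (0 : ℝ) < N := by positivity
  let f : (Fin d → ℝ) → ℝ := fun y => (N : ℝ)⁻¹ * Q.indicator 1 y
  have hfm : Measurable f := (measurable_one.indicator hQ).const_mul _
  have hfL : MemLp f 2 ν := ((memLp_const (1 : ℝ)).indicator hQ).const_mul _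
  have hind : ν[Q.indicator (1 : (Fin d → ℝ) → ℝ)] = ν.real Q := integral_indicator_one hQ
  let Z : (Fin N → (Fin d → ℝ)) → ℝ := ∑ j, fun x => f (x j)
  have hfj : ∀ j, MemLp (fun x : Fin N → (Fin d → ℝ) => f (x j)) 2 P := fun j =>
    hfL.comp_measurePreserving (measurePreserving_eval _ j)
  have hZL : MemLp Z 2 P := memLp_finsetSum' _ fun j _ => hfj j
  have hZapp : ∀ x, Z x = ∑ j, f (x j) := fun x => by simp [Z]
  have hmean : P[Z] = ν.real Q := by
    simp_rw [hZapp]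
    rw [integral_finsetSum _ fun j _ => (hfj j).integrable one_le_two]
    have : ∀ j : Fin N, ∫ x, f (x j) ∂P = (N : ℝ)⁻¹ * ν.real Q := fun j => by
      rw [← hind, ← integral_const_mul]
      exact integral_comp_eval (i := j) hfm.aestronglyMeasurable
    simp [this, hN0.ne']
  have hvar : variance Z P ≤ ν.real Q / N := by
    have h1 : variance f ν ≤ (N : ℝ)⁻¹ ^ 2 * ν.real Q := by
      refine (variance_le_expectation_sq hfm.aestronglyMeasurable).trans ?_
      rw [← hind, ← integral_const_mul]
      refine le_of_eq (integral_congr_ae (Filter.Eventually.of_forall fun y => ?_))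
      by_cases hy : y ∈ Q <;> simp [f, hy]
    rw [variance_sum_pi fun _ => hfL]
    calc _ ≤ ∑ _j : Fin N, (N : ℝ)⁻¹ ^ 2 * ν.real Q := Finset.sum_le_sum fun _ _ => h1
      _ = _ := by
        simp only [Finset.sum_const, Finset.card_univ, Fintype.card_fin, nsmul_eq_mul]
        field_simp
  have hWL : MemLp (fun x => |Z x - P[Z]|) 2 P := (hZL.sub (memLp_const _)).abs
  have habs : ∫ x, |Z x - P[Z]| ∂P ≤ √(ν.real Q / N) := by
    refine Real.le_sqrt_of_sq_le (le_trans ?_ hvar)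
    rw [variance_eq_integral hZL.aestronglyMeasurable.aemeasurable]
    have h0 := variance_nonneg (fun x => |Z x - P[Z]|) P
    rw [variance_eq_sub hWL] at h0
    have h2 : P[(fun x => |Z x - P[Z]|) ^ 2] = ∫ x, (Z x - P[Z]) ^ 2 ∂P := by
      simp only [Pi.pow_apply, sq_abs]
    linarith
  calc _ ≤ ∫⁻ x, ENNReal.ofReal |Z x - P[Z]| ∂P := by
        refine lintegral_mono fun x => ?_
        have hemp : empMeas N x Q = ENNReal.ofReal (Z x) := by
          rw [empMeas_apply x hQ, hZapp, ← Finset.mul_sum, ENNReal.ofReal_mul (by positivity),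
            ENNReal.ofReal_inv_of_pos hN0, ENNReal.ofReal_natCast,
            ENNReal.ofReal_sum_of_nonneg fun j _ => Set.indicator_nonneg (by simp) _]
          congr 1
          refine Finset.sum_congr rfl fun j _ => ?_
          by_cases hy : x j ∈ Q <;> simp [hy]
        have hZ0 : 0 ≤ Z x := by
          rw [hZapp]
          exact Finset.sum_nonneg fun j _ =>
            mul_nonneg (by positivity) (Set.indicator_nonneg (by simp) _)
        simp only [hemp]
        rw [← ofReal_measureReal, ← ENNReal.ofReal_sub _ hZ0, ← hmean, abs_sub_comm]
        exact ENNReal.ofReal_le_ofReal (le_abs_self _)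
    _ = ENNReal.ofReal (∫ x, |Z x - P[Z]| ∂P) :=
        (ofReal_integral_eq_lintegral_ofReal (hWL.integrable one_le_two)
          (Filter.Eventually.of_forall fun _ => abs_nonneg _)).symm
    _ ≤ _ := by
        rw [← Real.sqrt_div' _ hN0.le]
        exact ENNReal.ofReal_le_ofReal habs

lemma sum_sqrt_cell_le {d n : ℕ} (ν : Measure (Fin d → ℝ)) [IsFiniteMeasure ν]
    (T : Finset (Fin d → ℤ)) :
    ∑ q ∈ T, √(ν.real (cellMap d n ⁻¹' {q})) ≤ √(ν.real (cellMap d n ⁻¹' T)) * √T.card := by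
  have h := Real.sum_sqrt_mul_sqrt_le T (f := fun q => ν.real (cellMap d n ⁻¹' {q}))
    (g := fun _ => 1) (fun _ => measureReal_nonneg) (fun _ => zero_le_one)
  rw [sum_measureReal_preimage_singleton T
    fun q _ => measurable_cellMap d n (measurableSet_singleton q)] at h
  simpa using h

lemma card_le_of_cell_inter_nonempty {d n : ℕ} {K : Set (Fin d → ℝ)} (hK : IsCompact K)
    {S : Finset (Fin d → ℤ)} (hS : ∀ q ∈ S, ∃ y ∈ K, cellMap d n y = q) :
    (S.card : ℝ) ≤ volume.real (Metric.cthickening ((1 / 2) ^ n) K) * 2 ^ (d * n) := by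
  have hsub : cellMap d n ⁻¹' S ⊆ Metric.cthickening ((1 / 2) ^ n) K := by
    intro x hx
    obtain ⟨y, hyK, hy⟩ := hS _ hx
    refine Metric.mem_cthickening_of_dist_le x y _ _ hyK ?_
    have := nnnorm_sub_le_of_cellMap_eq d n x y hy.symm
    rw [← enorm_eq_nnnorm, ← ofReal_norm, ENNReal.ofReal_le_ofReal_iff (by positivity)] at this
    rwa [dist_eq_norm]
  have hcell : ∀ q, volume.real (cellMap d n ⁻¹' {q}) = ((2 : ℝ) ^ (d * n))⁻¹ := fun q => by
    rw [measureReal_def, volume_cell, ENNReal.toReal_ofReal (by positivity)]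
  have hsum := sum_measureReal_preimage_singleton (μ := volume) S (f := cellMap d n)
    (fun q _ => measurable_cellMap d n (measurableSet_singleton q))
    (fun q _ => by rw [volume_cell]; exact ENNReal.ofReal_ne_top)
  simp only [hcell, Finset.sum_const, nsmul_eq_mul] at hsum
  rw [← div_le_iff₀ (by positivity), div_eq_mul_inv, hsum]
  exact measureReal_mono hsub hK.isBounded.cthickening.measure_lt_top.ne

/-- For a singular measure the sum of the square roots of the masses of the dyadic cubes of
side length `2⁻ⁿ` is negligible compared to the square root of the number of cubes. -/
lemma tendsto_sum_sqrt_cell_div {d : ℕ} (ν : Measure (Fin d → ℝ)) [IsProbabilityMeasure ν]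
    (hsing : ν ⟂ₘ (volume : Measure (Fin d → ℝ))) :
    Tendsto (fun n : ℕ => (∑ q ∈ cells d n, √(ν.real (cellMap d n ⁻¹' {q}))) / √(2 ^ (d * n)))
      atTop (𝓝 0) := by
  classical
  obtain ⟨s, hs, hνs, hvs⟩ := hsing
  rw [Metric.tendsto_atTop]
  intro ε hε
  obtain ⟨K, hKs, hK, hνK⟩ := hs.compl.exists_isCompact_sdiff_lt (μ := ν) (measure_ne_top _ _)
    (ε := ENNReal.ofReal ((ε / 2) ^ 2)) (by simp; positivity)
  have hνK' : ν.real Kᶜ < (ε / 2) ^ 2 := by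
    have h1 : ν Kᶜ ≤ ν (sᶜ \ K) := by
      calc ν Kᶜ ≤ ν (s ∪ (sᶜ \ K)) := by
            refine measure_mono fun x hx => ?_
            by_cases hxs : x ∈ s
            · exact Or.inl hxs
            · exact Or.inr ⟨hxs, hx⟩
        _ ≤ ν s + ν (sᶜ \ K) := measure_union_le _ _
        _ = _ := by rw [hνs, zero_add]
    rw [measureReal_def, ← ENNReal.toReal_ofReal (by positivity : 0 ≤ (ε / 2) ^ 2)]
    exact (ENNReal.toReal_lt_toReal (measure_ne_top _ _) ENNReal.ofReal_ne_top).2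
      (h1.trans_lt hνK)
  have hvol : Tendsto (fun n : ℕ => volume.real (Metric.cthickening ((1 / 2 : ℝ) ^ n) K))
      atTop (𝓝 0) := by
    have h1 : Tendsto (fun n : ℕ => (1 / 2 : ℝ) ^ n) atTop (𝓝 0) :=
      tendsto_pow_atTop_nhds_zero_of_lt_one (by norm_num) (by norm_num)
    have h2 := (tendsto_measure_cthickening_of_isCompact (μ := volume) hK).comp h1
    rw [measure_mono_null hKs hvs] at h2
    exact (ENNReal.tendsto_toReal ENNReal.zero_ne_top).comp h2
  obtain ⟨n₀, hn₀⟩ := eventually_atTop.1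
    (hvol.eventually (gt_mem_nhds (by positivity : (0 : ℝ) < (ε / 2) ^ 2)))
  refine ⟨n₀, fun n hn => ?_⟩
  have hpow : (0 : ℝ) < √(2 ^ (d * n)) := by positivity
  rw [Real.dist_eq, sub_zero, abs_of_nonneg (by positivity), div_lt_iff₀ hpow]
  have hnear : ∑ q ∈ cells d n with ∃ y ∈ K, cellMap d n y = q,
      √(ν.real (cellMap d n ⁻¹' {q})) ≤ ε / 2 * √(2 ^ (d * n)) := by
    refine (sum_sqrt_cell_le ν _).trans ?_
    have h1 : √(ν.real (cellMap d n ⁻¹'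
        ({q ∈ cells d n | ∃ y ∈ K, cellMap d n y = q} : Finset _))) ≤ 1 :=
      Real.sqrt_le_one.2 measureReal_le_one
    have h2 := card_le_of_cell_inter_nonempty (n := n) hK
      (S := {q ∈ cells d n | ∃ y ∈ K, cellMap d n y = q}) fun q hq => (Finset.mem_filter.1 hq).2
    calc _ ≤ 1 * √((ε / 2) ^ 2 * 2 ^ (d * n)) := by
          gcongr
          exact h2.trans (by gcongr; exact (hn₀ n hn).le)
      _ = _ := by rw [one_mul, Real.sqrt_mul (by positivity), Real.sqrt_sq (by positivity)]
  have hfar : ∑ q ∈ cells d n with ¬ ∃ y ∈ K, cellMap d n y = q,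
      √(ν.real (cellMap d n ⁻¹' {q})) < ε / 2 * √(2 ^ (d * n)) := by
    refine (sum_sqrt_cell_le ν _).trans_lt ?_
    have h1 : √(ν.real (cellMap d n ⁻¹'
        ({q ∈ cells d n | ¬ ∃ y ∈ K, cellMap d n y = q} : Finset _))) < ε / 2 := by
      rw [Real.sqrt_lt' (by positivity)]
      refine (measureReal_mono ?_).trans_lt hνK'
      intro x hx hxK
      exact (Finset.mem_filter.1 hx).2 ⟨x, hxK, rfl⟩
    have h2 : √(({q ∈ cells d n | ¬ ∃ y ∈ K, cellMap d n y = q} : Finset _).card : ℝ) ≤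
        √(2 ^ (d * n)) := by
      refine Real.sqrt_le_sqrt ?_
      have := Finset.card_filter_le (cells d n) fun q => ¬ ∃ y ∈ K, cellMap d n y = q
      rw [card_cells] at this
      exact_mod_cast this
    calc _ ≤ _ * √(2 ^ (d * n)) := by gcongr
      _ < _ := by gcongr
  rw [← Finset.sum_filter_add_sum_filter_not (cells d n) fun q => ∃ y ∈ K, cellMap d n y = q]
  linarith

/-- Upper bound for the expected Wasserstein distance by dyadic discretization. -/
lemma expWpPow_le {d : ℕ} {p : ℝ} (hp : 0 ≤ p) (ν : Measure (Fin d → ℝ))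
    [IsProbabilityMeasure ν] (hν : ν (unitBox d)ᶜ = 0) {N : ℕ} (hN : N ≠ 0) (n : ℕ) :
    expWpPow p ν N ≤ ENNReal.ofReal (((1 / 2) ^ n) ^ p + ∑ k ∈ Finset.range n,
      ((1 / 2) ^ k) ^ p *
        ((∑ q ∈ cells d (k + 1), √(ν.real (cellMap d (k + 1) ⁻¹' {q}))) / √N)) := by
  set D : ℕ → ℝ≥0∞ := fun k => ENNReal.ofReal ((1 / 2) ^ k)
  have hDp : ∀ k, D k ^ p = ENNReal.ofReal (((1 / 2) ^ k) ^ p) := fun k =>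
    ENNReal.ofReal_rpow_of_pos (by positivity)
  have hm : ∀ k q, MeasurableSet (cellMap d k ⁻¹' {q}) := fun k q =>
    measurable_cellMap d k (measurableSet_singleton q)
  have hmeas : ∀ k q, Measurable fun x : Fin N → (Fin d → ℝ) =>
      ν (cellMap d k ⁻¹' {q}) - empMeas N x (cellMap d k ⁻¹' {q}) := by
    intro k q
    simp_rw [empMeas_apply _ (hm k q)]
    refine measurable_const.sub (Measurable.const_mul ?_ _)
    exact Finset.measurable_sum _ fun j _ =>
      (measurable_one.indicator (hm k q)).comp (measurable_pi_apply j)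
  have hae : ∀ᵐ x ∂(Measure.pi fun _ : Fin N => ν), ∀ j, x j ∈ unitBox d := by
    rw [ae_all_iff]
    intro j
    exact Measure.tendsto_eval_ae_ae.eventually (mem_ae_iff.2 hν)
  calc expWpPow p ν N ≤ ∫⁻ x, (D n ^ p + ∑ k ∈ Finset.range n, D k ^ p *
        ∑ q ∈ cells d (k + 1), (ν (cellMap d (k + 1) ⁻¹' {q}) -
          empMeas N x (cellMap d (k + 1) ⁻¹' {q}))) ∂(Measure.pi fun _ : Fin N => ν) := by
        refine lintegral_mono_ae (hae.mono fun x hx => ?_)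
        have := isProbabilityMeasure_empMeas hN x
        have hx0 : empMeas N x (unitBox d)ᶜ = 0 := by
          rw [empMeas_apply _ (by
            rw [unitBox_eq_fiber]; exact (hm 0 0).compl)]
          simp [hx]
        obtain ⟨ξ, hξ, hcost⟩ := exists_coupling_hierarchical (measurable_cellMap d)
          (cellMap_factors d) (D := D) (nnnorm_sub_le_of_cellMap_eq d) hp n ν (empMeas N x)
          fun q => by rw [measure_cell_of_unitBox hν, measure_cell_of_unitBox hx0]
        refine (iInf₂_le ξ hξ).trans (hcost.trans (le_of_eq ?_))
        rw [measure_univ, mul_one]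
        congr 1
        refine Finset.sum_congr rfl fun k _ => ?_
        rw [tsum_eq_sum fun q hq => ?_]
        rw [measure_cell_eq_zero hν hq, zero_tsub]
    _ = D n ^ p + ∑ k ∈ Finset.range n, D k ^ p * ∑ q ∈ cells d (k + 1),
        ∫⁻ x, (ν (cellMap d (k + 1) ⁻¹' {q}) - empMeas N x (cellMap d (k + 1) ⁻¹' {q}))
          ∂(Measure.pi fun _ : Fin N => ν) := by
        rw [lintegral_add_left measurable_const, lintegral_const, measure_univ, mul_one,
          lintegral_finsetSum _ fun k _ =>
            (Finset.measurable_sum _ fun q _ => hmeas _ _).const_mul _]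
        congr 1
        refine Finset.sum_congr rfl fun k _ => ?_
        rw [lintegral_const_mul _ (Finset.measurable_sum _ fun q _ => hmeas _ _),
          lintegral_finsetSum _ fun q _ => hmeas _ _]
    _ ≤ D n ^ p + ∑ k ∈ Finset.range n, D k ^ p * ∑ q ∈ cells d (k + 1),
        ENNReal.ofReal (√(ν.real (cellMap d (k + 1) ⁻¹' {q})) / √N) := by
        gcongr with k _ q _
        exact lintegral_sub_empMeas_le hN ν (hm _ _)
    _ = _ := by
        rw [ENNReal.ofReal_add (by positivity) (by positivity),
          ENNReal.ofReal_sum_of_nonneg fun _ _ => by positivity, hDp]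
        congr 1
        refine Finset.sum_congr rfl fun k _ => ?_
        rw [ENNReal.ofReal_mul (by positivity), hDp, Finset.sum_div,
          ENNReal.ofReal_sum_of_nonneg fun _ _ => by positivity]

/-- Averages of a null sequence with geometrically growing weights tend to zero. -/
lemma tendsto_sum_mul_pow_div_pow {u : ℕ → ℝ} (hu : Tendsto u atTop (𝓝 0)) {r : ℝ} (hr : 1 < r) :
    Tendsto (fun n => (∑ k ∈ Finset.range n, u k * r ^ k) / r ^ n) atTop (𝓝 0) := by
  have hr0 : 0 < r := by linarith
  have h1 : (fun k => u k * r ^ k) =o[atTop] fun k => r ^ k := by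
    refine Asymptotics.isLittleO_of_tendsto (fun k hk => by simp [hk]) ?_
    refine hu.congr fun k => ?_
    rw [mul_div_cancel_right₀ _ (by positivity)]
  have hge : ∀ n : ℕ, ∑ i ∈ Finset.range n, r ^ i = (r ^ n - 1) / (r - 1) := fun n =>
    geom_sum_eq hr.ne' n
  have h2 := h1.sum_range (fun k => by positivity) (by
    simp_rw [hge]
    exact (tendsto_atTop_add_const_right _ _ (tendsto_pow_atTop_atTop_of_one_lt hr)).atTop_div_const
      (by linarith))
  have h3 : (fun n => ∑ i ∈ Finset.range n, r ^ i) =O[atTop] fun n => r ^ n := by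
    refine Asymptotics.IsBigO.of_bound (r - 1)⁻¹ (Eventually.of_forall fun n => ?_)
    have : 0 ≤ ∑ i ∈ Finset.range n, r ^ i := by positivity
    rw [Real.norm_of_nonneg this, Real.norm_of_nonneg (by positivity), hge, div_eq_inv_mul]
    have : 0 < (r - 1)⁻¹ := inv_pos.2 (by linarith)
    gcongr
    linarith
  exact (h2.trans_isBigO h3).tendsto_div_nhds_zero

lemma rpow_mul_dyadic_term {d : ℕ} {p t b : ℝ} (ht : 0 < t) (k : ℕ) :
    t ^ p * (((1 / 2) ^ k) ^ p * (b / t ^ ((d : ℝ) / 2))) =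
      √(2 ^ d) / t ^ ((d : ℝ) / 2 - p) *
        (b / √(2 ^ (d * (k + 1))) * ((2 : ℝ) ^ ((d : ℝ) / 2 - p)) ^ k) := by
  have h1 : √((2 : ℝ) ^ (d * (k + 1))) = √(2 ^ d) * ((2 : ℝ) ^ k) ^ ((d : ℝ) / 2) := by
    rw [mul_add, mul_one, add_comm, pow_add, Real.sqrt_mul (by positivity)]
    congr 1
    rw [Real.sqrt_eq_rpow, mul_comm d k, pow_mul, ← Real.rpow_natCast _ d,
      ← Real.rpow_mul (by positivity)]
    ring_nf
  have h2 : ((2 : ℝ) ^ ((d : ℝ) / 2 - p)) ^ k =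
      ((2 : ℝ) ^ k) ^ ((d : ℝ) / 2) / ((2 : ℝ) ^ k) ^ p := by
    rw [← Real.rpow_sub (by positivity), ← Real.rpow_natCast, ← Real.rpow_natCast,
      ← Real.rpow_mul (by positivity), ← Real.rpow_mul (by positivity), mul_comm]
  have h3 : (((1 : ℝ) / 2) ^ k) ^ p = (((2 : ℝ) ^ k) ^ p)⁻¹ := by
    rw [one_div, inv_pow, Real.inv_rpow (by positivity)]
  rw [h1, h2, h3, Real.rpow_sub ht]
  have : 0 < √((2 : ℝ) ^ d) := by positivity
  field_simp

lemma tendsto_rpow_mul_expWpPow {d : ℕ} (hd : 0 < d) {p : ℝ} (hp : 0 < p) (hpd : 2 * p < d)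
    (ν : Measure (Fin d → ℝ)) [IsProbabilityMeasure ν] (hν : ν (unitBox d)ᶜ = 0)
    (hsing : ν ⟂ₘ (volume : Measure (Fin d → ℝ))) :
    Tendsto (fun N : ℕ => ((N : ℝ≥0∞) ^ ((d : ℝ)⁻¹)) ^ p * expWpPow p ν N) atTop (𝓝 0) := by
  have hd' : (0 : ℝ) < d := by exact_mod_cast hd
  set a : ℝ := (d : ℝ) / 2 - p with ha_def
  have ha : 0 < a := by linarith
  set b : ℕ → ℝ := fun n => ∑ q ∈ cells d n, √(ν.real (cellMap d n ⁻¹' {q})) with hb_def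
  set r : ℝ := (2 : ℝ) ^ a with hr_def
  have hr : 1 < r := Real.one_lt_rpow (by norm_num) ha
  have hu : Tendsto (fun k => b (k + 1) / √(2 ^ (d * (k + 1)))) atTop (𝓝 0) :=
    (tendsto_sum_sqrt_cell_div ν hsing).comp (tendsto_add_atTop_nat 1)
  have hw := tendsto_sum_mul_pow_div_pow hu hr
  have hmain : ∀ ε : ℝ, 0 < ε → ∀ᶠ N : ℕ in atTop,
      ((N : ℝ≥0∞) ^ ((d : ℝ)⁻¹)) ^ p * expWpPow p ν N ≤ ENNReal.ofReal ε := by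
    intro ε hε
    obtain ⟨m, hm⟩ : ∃ m : ℕ, (2 / 2 ^ m : ℝ) ^ p < ε / 2 := by
      have h1 : Tendsto (fun m : ℕ => (2 / 2 ^ m : ℝ)) atTop (𝓝 0) :=
        Tendsto.const_div_atTop (tendsto_pow_atTop_atTop_of_one_lt (one_lt_two (α := ℝ))) 2
      have h2 := h1.rpow_const (p := p) (Or.inr hp.le)
      rw [Real.zero_rpow hp.ne'] at h2
      exact (h2.eventually (gt_mem_nhds (half_pos hε))).exists
    set C : ℝ := √(2 ^ d) * (2 ^ m) ^ a with hC_def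
    have hC : 0 < C := by positivity
    obtain ⟨n₁, hn₁⟩ := eventually_atTop.1
      (hw.eventually (gt_mem_nhds (by positivity : (0 : ℝ) < ε / 2 / C)))
    have ht : Tendsto (fun N : ℕ => (N : ℝ) ^ ((d : ℝ)⁻¹)) atTop atTop :=
      (tendsto_rpow_atTop (inv_pos.2 hd')).comp tendsto_natCast_atTop_atTop
    filter_upwards [ht.eventually_ge_atTop (2 ^ n₁), eventually_ge_atTop 1] with N hN hN1
    have hN0 : N ≠ 0 := by omega
    set t : ℝ := (N : ℝ) ^ ((d : ℝ)⁻¹) with ht_def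
    have hNpos : (0 : ℝ) < N := by positivity
    have ht1 : 1 ≤ t := Real.one_le_rpow (by exact_mod_cast hN1) (by positivity)
    have ht0 : 0 < t := by linarith
    obtain ⟨n₀, hn₀, hn₀'⟩ := exists_nat_pow_near ht1 (one_lt_two (α := ℝ))
    have hn : n₁ ≤ n₀ + m := by
      have := (pow_lt_pow_iff_right₀ (one_lt_two (α := ℝ))).1 (hN.trans_lt hn₀')
      omega
    have hsqrt : √(N : ℝ) = t ^ ((d : ℝ) / 2) := by
      rw [ht_def, ← Real.rpow_mul hNpos.le, Real.sqrt_eq_rpow]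
      congr 1
      field_simp
    have htE : ((N : ℝ≥0∞) ^ ((d : ℝ)⁻¹)) ^ p = ENNReal.ofReal (t ^ p) := by
      rw [← ENNReal.ofReal_rpow_of_pos ht0, ht_def, ← ENNReal.ofReal_rpow_of_pos hNpos,
        ENNReal.ofReal_natCast]
    rw [htE]
    refine (mul_le_mul' le_rfl (expWpPow_le hp.le ν hν hN0 (n₀ + m))).trans ?_
    rw [← ENNReal.ofReal_mul (by positivity)]
    refine ENNReal.ofReal_le_ofReal ?_
    rw [mul_add, Finset.mul_sum, hsqrt,
      Finset.sum_congr rfl fun k _ => rpow_mul_dyadic_term (d := d) (p := p) (b := b (k + 1)) ht0 k,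
      ← Finset.mul_sum]
    have hfirst : t ^ p * ((1 / 2) ^ (n₀ + m)) ^ p ≤ ε / 2 := by
      rw [← Real.mul_rpow (by positivity) (by positivity)]
      refine le_trans (Real.rpow_le_rpow (by positivity) ?_ hp.le) hm.le
      calc t * (1 / 2) ^ (n₀ + m) ≤ 2 ^ (n₀ + 1) * (1 / 2) ^ (n₀ + m) := by gcongr
        _ = _ := by
          rw [one_div, inv_pow, pow_add, pow_add]
          field_simp
    have hsecond : √(2 ^ d) / t ^ a * ∑ k ∈ Finset.range (n₀ + m),
        b (k + 1) / √(2 ^ (d * (k + 1))) * r ^ k ≤ ε / 2 := by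
      have h1 := (div_lt_iff₀ (by positivity)).1 (hn₁ (n₀ + m) hn)
      have h2 : r ^ (n₀ + m) ≤ (2 ^ m) ^ a * t ^ a := by
        have : r ^ (n₀ + m) = ((2 : ℝ) ^ (n₀ + m)) ^ a := by
          rw [hr_def, ← Real.rpow_natCast, ← Real.rpow_natCast, ← Real.rpow_mul (by positivity),
            ← Real.rpow_mul (by positivity), mul_comm]
        rw [this, ← Real.mul_rpow (by positivity) (by positivity), pow_add, mul_comm]
        gcongr
      calc _ ≤ √(2 ^ d) / t ^ a * (ε / 2 / C * ((2 ^ m) ^ a * t ^ a)) := by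
            gcongr
            exact h1.le.trans (by gcongr)
        _ = _ := by
            rw [hC_def]
            have : 0 < √((2 : ℝ) ^ d) := by positivity
            field_simp
    linarith
  rw [ENNReal.tendsto_nhds_zero]
  intro ε hε
  rcases eq_or_ne ε ⊤ with rfl | hε'
  · simp
  · have := hmain ε.toReal (ENNReal.toReal_pos hε.ne' hε')
    rwa [ENNReal.ofReal_toReal hε'] at this

/-- For a finite nonzero measure `μ` on `[0,1)^d` that is singular with respect to
Lebesgue measure, the empirical measures of the normalization `μ/‖μ‖` satisfy
`lim_N N^{1/d} E[ρ_p^p(μ/‖μ‖, μ̂_N)]^{1/p} = 0` for `1 ≤ p < d/2`, `d ≥ 3`. -/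
theorem singular_high_resolution_zero {d : ℕ} (hd : 3 ≤ d) (p : ℝ)
    (hp : 1 ≤ p) (hpd : 2 * p < d)
    (μ : Measure (Fin d → ℝ)) [IsFiniteMeasure μ] (hμ0 : μ ≠ 0)
    (hsupp : μ (unitBox d)ᶜ = 0) (hsing : μ ⟂ₘ (volume : Measure (Fin d → ℝ))) :
    Filter.Tendsto (fun N : ℕ => (N : ℝ≥0∞) ^ ((d : ℝ)⁻¹) *
        (expWpPow p ((μ Set.univ)⁻¹ • μ) N) ^ (1 / p))
      Filter.atTop (nhds 0) := by
  have hp0 : 0 < p := by linarith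
  have : NeZero μ := ⟨hμ0⟩
  have h := tendsto_rpow_mul_expWpPow (by omega : 0 < d) hp0 hpd ((μ Set.univ)⁻¹ • μ)
    (by simp [hsupp]) (hsing.smul _)
  have h1p : 0 < 1 / p := by positivity
  have h2 := h.ennrpow_const (1 / p)
  rw [ENNReal.zero_rpow_of_pos h1p] at h2
  refine h2.congr fun N => ?_
  rw [ENNReal.mul_rpow_of_nonneg _ _ h1p.le, ← ENNReal.rpow_mul _ p, mul_one_div_cancel hp0.ne',
    ENNReal.rpow_one]
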